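/- arXiv:2303.00858 — 3 statements merged into one kernel-verified Lean document; each statement's English description precedes it below -/
import Mathlib

section
/- Discrete-time additive functional generation within one market epoch: Let n ≥ 1, let G : ℝ^n → ℝ be continuously differentiable, and let x_0, x_1, …, x_J ∈ Δ_n. Define Γ_0 := 0 and Γ_j := Γ_{j−1} − d_{B,G}(x_j, x_{j−1}) for j = 1,…,J, set V_j := G(x_j) + Γ_j, and define the holdings φ_i(j) := ∂_i G(x_{j−1}) + V_{j−1} − Σ_{k=1}^n ∂_k G(x_{j−1}) x_k(j−1) for i = 1,…,n and j = 1,…,J. Then for every j = 1,…,J one has Σ_{i=1}^n φ_i(j) x_i(j−1) = V_{j−1} and Σ_{i=1}^n φ_i(j) x_i(j) = V_j; that is, φ is a self-financing strategy whose wealth equals the generating function value G(x_j) plus the accumulated negative Bregman divergences Γ_j. -/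
open Finset

/-- The partial derivative `∂ᵢ G (x)` of a function `G : ℝⁿ → ℝ`,
defined via the Fréchet derivative applied to the `i`-th basis vector. -/
noncomputable def pderivR {n : ℕ} (G : (Fin n → ℝ) → ℝ) (i : Fin n) (x : Fin n → ℝ) : ℝ :=
  fderiv ℝ G x (Pi.single i 1)

/-- The Bregman divergence `d_{B,G}(x, y) = G(x) - G(y) - ∑ᵢ ∂ᵢG(y)(xᵢ - yᵢ)`. -/
noncomputable def bregman {n : ℕ} (G : (Fin n → ℝ) → ℝ) (x y : Fin n → ℝ) : ℝ :=
  G x - G y - ∑ i, pderivR G i y * (x i - y i)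

/-- Discrete-time additive functional generation within one market epoch:
the additively generated strategy `φ` is self-financing with wealth
`V_j = G(x_j) + Γ_j`. -/
theorem discrete_additive_generation
    (n J : ℕ) (hn : 1 ≤ n)
    (G : (Fin n → ℝ) → ℝ) (hG : ContDiff ℝ 1 G)
    (x : ℕ → Fin n → ℝ) (hx : ∀ j ≤ J, x j ∈ stdSimplex ℝ (Fin n))
    (Γ : ℕ → ℝ) (hΓ0 : Γ 0 = 0)
    (hΓ : ∀ j, 1 ≤ j → j ≤ J → Γ j = Γ (j - 1) - bregman G (x j) (x (j - 1)))
    (V : ℕ → ℝ) (hV : ∀ j ≤ J, V j = G (x j) + Γ j)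
    (φ : ℕ → Fin n → ℝ)
    (hφ : ∀ j, 1 ≤ j → j ≤ J → ∀ i, φ j i =
      pderivR G i (x (j - 1)) + V (j - 1)
        - ∑ k, pderivR G k (x (j - 1)) * x (j - 1) k) :
    ∀ j, 1 ≤ j → j ≤ J →
      (∑ i, φ j i * x (j - 1) i = V (j - 1)) ∧ (∑ i, φ j i * x j i = V j) := by
  intro j hj hjJ
  have weighted_sum (y : Fin n → ℝ) (hy : y ∈ stdSimplex ℝ (Fin n)) :
      ∑ i, φ j i * y i = V (j - 1) + ∑ i, pderivR G i (x (j - 1)) * (y i - x (j - 1) i) := by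
    simp only [hφ j hj hjJ, add_sub_assoc, add_mul, mul_sub, sum_add_distrib, sum_sub_distrib,
      ← mul_sum, hy.2]
    ring
  refine ⟨by simp [weighted_sum _ (hx (j - 1) (by omega))], ?_⟩
  rw [weighted_sum _ (hx j hjJ), hV j hjJ, hV (j - 1) (by omega), hΓ j hj hjJ, bregman]
  ring
end

section
/- Discrete-time multiplicative functional generation within one market epoch: Let n ≥ 1, let G : ℝ^n → ℝ be continuously differentiable with G(x) > 0 for all x ∈ Δ_n, and let x_0, x_1, …, x_J ∈ Δ_n. Define E_0 := 1 and E_j := E_{j−1}·(1 − d_{B,G}(x_j, x_{j−1})/G(x_j)) for j = 1,…,J, set V_j := G(x_j)·E_j, and define the holdings ψ_i(j) := E_{j−1}·(∂_i G(x_{j−1}) − Σ_{k=1}^n ∂_k G(x_{j−1}) x_k(j−1)) + V_{j−1} for i = 1,…,n and j = 1,…,J. Then for every j = 1,…,J one has Σ_{i=1}^n ψ_i(j) x_i(j−1) = V_{j−1} and Σ_{i=1}^n ψ_i(j) x_i(j) = V_j; that is, ψ is a self-financing strategy whose wealth equals the generating function value times the product of the factors (1 − d_{B,G}(x_q, x_{q−1})/G(x_q)).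 -/
open Finset

/-- Pairing an affine function `a * (p i - c) + v` of `p` with weights `z` of total mass one. -/
theorem sum_mul_of_sum_eq_one {ι : Type*} [Fintype ι] (a v c : ℝ) (p z : ι → ℝ)
    (hz : ∑ i, z i = 1) :
    ∑ i, (a * (p i - c) + v) * z i = a * (∑ i, p i * z i - c) + v := by
  calc ∑ i, (a * (p i - c) + v) * z i = ∑ i, (a * (p i * z i) + (v - a * c) * z i) :=
        Finset.sum_congr rfl fun i _ ↦ by ring
    _ = a * (∑ i, p i * z i - c) + v := by
        rw [Finset.sum_add_distrib, ← Finset.mul_sum, ← Finset.mul_sum, hz]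
        ring

/-- Discrete-time multiplicative functional generation within one market epoch:
the multiplicatively generated strategy `ψ` is self-financing with wealth
`V_j = G(x_j) · E_j`, where `E_j` is the product of factors
`1 - d_{B,G}(x_q, x_{q-1})/G(x_q)`. -/
theorem discrete_multiplicative_generation
    (n J : ℕ) (hn : 1 ≤ n)
    (G : (Fin n → ℝ) → ℝ) (hG : ContDiff ℝ 1 G)
    (hGpos : ∀ y ∈ stdSimplex ℝ (Fin n), 0 < G y)
    (x : ℕ → Fin n → ℝ) (hx : ∀ j ≤ J, x j ∈ stdSimplex ℝ (Fin n))
    (E : ℕ → ℝ) (hE0 : E 0 = 1)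
    (hE : ∀ j, 1 ≤ j → j ≤ J →
      E j = E (j - 1) * (1 - bregman G (x j) (x (j - 1)) / G (x j)))
    (V : ℕ → ℝ) (hV : ∀ j ≤ J, V j = G (x j) * E j)
    (ψ : ℕ → Fin n → ℝ)
    (hψ : ∀ j, 1 ≤ j → j ≤ J → ∀ i, ψ j i =
      E (j - 1) * (pderivR G i (x (j - 1))
          - ∑ k, pderivR G k (x (j - 1)) * x (j - 1) k)
        + V (j - 1)) :
    ∀ j, 1 ≤ j → j ≤ J →
      (∑ i, ψ j i * x (j - 1) i = V (j - 1)) ∧ (∑ i, ψ j i * x j i = V j) := by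
  intro j hj hjJ
  have hj' : j - 1 ≤ J := (Nat.sub_le j 1).trans hjJ
  have hpair := fun z hz ↦ sum_mul_of_sum_eq_one (E (j - 1)) (V (j - 1))
    (∑ k, pderivR G k (x (j - 1)) * x (j - 1) k) (fun i ↦ pderivR G i (x (j - 1))) z hz
  have hGj : G (x j) ≠ 0 := (hGpos _ (hx j hjJ)).ne'
  simp only [hψ j hj hjJ]
  refine ⟨by rw [hpair _ (hx _ hj').2]; ring, ?_⟩
  rw [hpair _ (hx j hjJ).2, hV j hjJ, hE j hj hjJ, hV _ hj', bregman]
  simp only [mul_sub, Finset.sum_sub_distrib]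
  field_simp
  ring
end

section
/- Bregman divergence identity for the diversity-weighted generating function: Fix p ∈ (0,1] and n ≥ 1, and let G_p(x) := (Σ_{i=1}^n x_i^p)^{1/p}. Then for all x, y ∈ ℝ^n with strictly positive entries, 1 − d_{B,G_p}(x,y)/G_p(x) = (Σ_{i=1}^n x_i y_i^{p−1}) / ((Σ_{i=1}^n x_i^p)^{1/p}·(Σ_{i=1}^n y_i^p)^{(p−1)/p}). Consequently, the discrete excess growth of the diversity-weighted portfolio over one step from y to x equals log(Σ_{i=1}^n x_i y_i^{p−1}) − (1/p)·log((Σ_{i=1}^n x_i^p)·(Σ_{i=1}^n y_i^p)^{p−1}). -/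
open Finset

/-- The diversity-weighted generating function `G_p(x) = (∑ᵢ xᵢ^p)^(1/p)`. -/
noncomputable def divG (n : ℕ) (p : ℝ) : (Fin n → ℝ) → ℝ :=
  fun z => (∑ i, z i ^ p) ^ (1 / p)

theorem pderivR_divG {n : ℕ} {p : ℝ} (hp : p ≠ 0) {y : Fin n → ℝ} (hy : ∀ i, 0 < y i)
    (i : Fin n) :
    pderivR (divG n p) i y = (∑ j, y j ^ p) ^ (1 / p - 1) * y i ^ (p - 1) := by
  have hS : 0 < ∑ j, y j ^ p :=
    Finset.sum_pos (fun j _ => Real.rpow_pos_of_pos (hy j) p) ⟨i, Finset.mem_univ i⟩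
  have hsum : HasFDerivAt (fun z : Fin n → ℝ => ∑ j, z j ^ p)
      (∑ j, (p * y j ^ (p - 1)) • ContinuousLinearMap.proj (R := ℝ) (φ := fun _ : Fin n => ℝ) j)
      y :=
    HasFDerivAt.fun_sum fun j _ => (hasFDerivAt_apply j y).rpow_const (Or.inl (hy j).ne')
  have hG : HasFDerivAt (divG n p) _ y := hsum.rpow_const (p := 1 / p) (Or.inl hS.ne')
  rw [pderivR, hG.fderiv]
  simp [Pi.single_apply]
  field_simp

/-- The tangent plane of the positively homogeneous function `divG n p` at `y` is linear. -/
theorem divG_sub_bregman {n : ℕ} {p : ℝ} (hn : 1 ≤ n) (hp : p ≠ 0) (x : Fin n → ℝ)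
    {y : Fin n → ℝ} (hy : ∀ i, 0 < y i) :
    divG n p x - bregman (divG n p) x y
      = (∑ i, x i * y i ^ (p - 1)) / (∑ i, y i ^ p) ^ ((p - 1) / p) := by
  have hS : 0 < ∑ j, y j ^ p :=
    Finset.sum_pos (fun j _ => Real.rpow_pos_of_pos (hy j) p) ⟨⟨0, hn⟩, Finset.mem_univ _⟩
  have euler : ∑ i, pderivR (divG n p) i y * y i = divG n p y := by
    have hterm : ∀ i, pderivR (divG n p) i y * y i = (∑ j, y j ^ p) ^ (1 / p - 1) * y i ^ p := by
      intro i
      rw [pderivR_divG hp hy, mul_assoc, ← Real.rpow_add_one (hy i).ne', sub_add_cancel]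
    simp_rw [hterm]
    rw [← Finset.mul_sum, ← Real.rpow_add_one hS.ne', sub_add_cancel, divG]
  have hexp : (p - 1) / p = -(1 / p - 1) := by field_simp; ring
  simp only [bregman, mul_sub, Finset.sum_sub_distrib]
  rw [euler, hexp, Real.rpow_neg hS.le, div_inv_eq_mul, Finset.sum_mul]
  have hlin : ∑ i, pderivR (divG n p) i y * x i
      = ∑ i, x i * y i ^ (p - 1) * (∑ j, y j ^ p) ^ (1 / p - 1) :=
    Finset.sum_congr rfl fun i _ => by rw [pderivR_divG hp hy]; ring
  rw [← hlin]
  ring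

/-- Bregman divergence identity for the diversity-weighted generating function:
`1 - d_{B,G_p}(x,y)/G_p(x) = (∑ᵢ xᵢ yᵢ^{p-1}) / ((∑ᵢ xᵢ^p)^{1/p} (∑ᵢ yᵢ^p)^{(p-1)/p})`,
and the one-step discrete excess growth equals
`log(∑ᵢ xᵢ yᵢ^{p-1}) - (1/p) log((∑ᵢ xᵢ^p)(∑ᵢ yᵢ^p)^{p-1})`. -/
theorem diversity_weighted_bregman_identity
    (n : ℕ) (hn : 1 ≤ n) (p : ℝ) (hp0 : 0 < p) (hp1 : p ≤ 1)
    (x y : Fin n → ℝ) (hx : ∀ i, 0 < x i) (hy : ∀ i, 0 < y i) :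
    (1 - bregman (divG n p) x y / divG n p x
      = (∑ i, x i * y i ^ (p - 1)) /
          ((∑ i, x i ^ p) ^ (1 / p) * (∑ i, y i ^ p) ^ ((p - 1) / p))) ∧
    (Real.log (1 - bregman (divG n p) x y / divG n p x)
      = Real.log (∑ i, x i * y i ^ (p - 1))
        - (1 / p) * Real.log ((∑ i, x i ^ p) * (∑ i, y i ^ p) ^ (p - 1))) := by
  have : NeZero n := ⟨by omega⟩
  have hpos : ∀ {f : Fin n → ℝ}, (∀ i, 0 < f i) → 0 < ∑ i, f i := fun hf =>
    Finset.sum_pos (fun i _ => hf i) Finset.univ_nonempty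
  have hSx : 0 < ∑ i, x i ^ p := hpos fun i => Real.rpow_pos_of_pos (hx i) p
  have hSy : 0 < ∑ i, y i ^ p := hpos fun i => Real.rpow_pos_of_pos (hy i) p
  have hT : 0 < ∑ i, x i * y i ^ (p - 1) :=
    hpos fun i => mul_pos (hx i) (Real.rpow_pos_of_pos (hy i) _)
  have hGx : 0 < divG n p x := Real.rpow_pos_of_pos hSx _
  have key : 1 - bregman (divG n p) x y / divG n p x
      = (∑ i, x i * y i ^ (p - 1)) /
          ((∑ i, x i ^ p) ^ (1 / p) * (∑ i, y i ^ p) ^ ((p - 1) / p)) := by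
    rw [one_sub_div hGx.ne', divG_sub_bregman hn hp0.ne' x hy, div_div, mul_comm, divG]
  refine ⟨key, ?_⟩
  have hA := Real.rpow_pos_of_pos hSx (1 / p)
  have hB := Real.rpow_pos_of_pos hSy ((p - 1) / p)
  rw [key, Real.log_div hT.ne' (mul_pos hA hB).ne', Real.log_mul hA.ne' hB.ne',
    Real.log_mul hSx.ne' (Real.rpow_pos_of_pos hSy _).ne', Real.log_rpow hSx, Real.log_rpow hSy,
    Real.log_rpow hSy]
  ring
end
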